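/- Let ζ denote the Riemann zeta function and γ the Euler–Mascheroni constant. Then ∑_{k=2}^n (−1)^k C(n,k) ζ(k) = n log n + (2γ − 1) n + O(1/n); that is, there is a constant C such that |∑_{k=2}^n (−1)^k C(n,k) ζ(k) − n log n − (2γ − 1) n| ≤ C/n for all n ≥ 2. -/

import Mathlib

open Finset

/-- Error bound for one step of the trapezoid rule, in terms of a function dominating the variation
of the derivative of the integrand. -/
lemma abs_trapezoid_step_le {H h g K : ℝ → ℝ} {a : ℝ}
    (hH : ∀ x, a ≤ x → HasDerivAt H (h x) x) (hh : ∀ x, a ≤ x → HasDerivAt h (g x) x)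
    (hsub : MonotoneOn (fun x => K x - g x) (Set.Ici a))
    (hadd : MonotoneOn (fun x => K x + g x) (Set.Ici a)) :
    |(h a + h (a + 1)) / 2 - (H (a + 1) - H a)| ≤ (K (a + 1) - K a) / 2 := by
  have hvar : ∀ x y, a ≤ x → x ≤ y → |g y - g x| ≤ K y - K x := by
    intro x y hx hxy
    have h1 := hsub (Set.mem_Ici.2 hx) (Set.mem_Ici.2 (hx.trans hxy)) hxy
    have h2 := hadd (Set.mem_Ici.2 hx) (Set.mem_Ici.2 (hx.trans hxy)) hxy
    simp only at h1 h2
    rw [abs_le]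
    constructor <;> linarith
  have hKmono : ∀ x y, a ≤ x → x ≤ y → K x ≤ K y := fun x y hx hxy => by
    linarith [(abs_nonneg _).trans (hvar x y hx hxy)]
  have hφ : ∀ x, a ≤ x → HasDerivAt (fun x => H x - H a - (x - a) * (h a + h x) / 2)
      ((h x - h a - (x - a) * g x) / 2) x := by
    intro x hx
    refine (((hH x hx).sub_const (H a)).sub ((((hasDerivAt_id x).sub_const a).mul
      ((hh x hx).const_add (h a))).div_const 2)).congr_deriv ?_
    simp only [id]
    ring
  obtain ⟨c, hc, hce⟩ := exists_hasDerivAt_eq_slope _ _ (lt_add_one a)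
    (fun x hx => (hφ x hx.1).continuousAt.continuousWithinAt) (fun x hx => hφ x hx.1.le)
  obtain ⟨d, hd, hde⟩ := exists_hasDerivAt_eq_slope h g hc.1
    (fun x hx => (hh x hx.1).continuousAt.continuousWithinAt) (fun x hx => hh x hx.1.le)
  have hca : 0 < c - a := sub_pos.2 hc.1
  rw [eq_div_iff hca.ne'] at hde
  have hb : |h c - h a - (c - a) * g c| ≤ K (a + 1) - K a := by
    rw [← hde, show g d * (c - a) - (c - a) * g c = -((g c - g d) * (c - a)) by ring, abs_neg,
      abs_mul, abs_of_pos hca]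
    have h1 := hvar d c hd.1.le hd.2.le
    have h2 := hKmono a d le_rfl hd.1.le
    have h3 := hKmono c (a + 1) hc.1.le hc.2.le
    have h4 : c - a ≤ 1 := by linarith [hc.2]
    nlinarith [abs_nonneg (g c - g d)]
  have he : (h a + h (a + 1)) / 2 - (H (a + 1) - H a)
      = -((h c - h a - (c - a) * g c) / 2) := by
    rw [hce]; ring
  rw [he, abs_neg, abs_div, abs_two]
  linarith

/-- Error bound for the composite trapezoid rule with unit steps. -/
lemma abs_trapezoid_sum_le {H h g K : ℝ → ℝ} {a : ℝ}
    (hH : ∀ x, a ≤ x → HasDerivAt H (h x) x) (hh : ∀ x, a ≤ x → HasDerivAt h (g x) x)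
    (hsub : MonotoneOn (fun x => K x - g x) (Set.Ici a))
    (hadd : MonotoneOn (fun x => K x + g x) (Set.Ici a)) (M : ℕ) :
    |∑ i ∈ range (M + 1), h (a + i) - (h a + h (a + M)) / 2 - (H (a + M) - H a)|
      ≤ (K (a + M) - K a) / 2 := by
  induction M with
  | zero => simp
  | succ M ih =>
    have ha : a ≤ a + M := by simp
    have hstep := abs_trapezoid_step_le (a := a + M) (fun x hx => hH x (ha.trans hx))
      (fun x hx => hh x (ha.trans hx)) (hsub.mono (Set.Ici_subset_Ici.2 ha))
      (hadd.mono (Set.Ici_subset_Ici.2 ha))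
    rw [sum_range_succ]
    push_cast
    rw [← add_assoc]
    rw [abs_le] at *
    constructor <;> linarith [ih.1, ih.2, hstep.1, hstep.2]

lemma one_sub_pow_add_two (m : ℕ) (y : ℝ) :
    (1 - y) ^ (m + 2) = 1 - (m + 2) * y
      + ∑ i ∈ range (m + 1), (-1 : ℝ) ^ i * ((m + 2).choose (i + 2) : ℝ) * y ^ (i + 2) := by
  rw [sub_eq_neg_add, add_pow, sum_range_succ', sum_range_succ']
  simp only [one_pow, mul_one, pow_zero, Nat.choose_zero_right, Nat.cast_one, zero_add, pow_one,
    Nat.choose_one_right]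
  have : ∀ i ∈ range (m + 1), (-y) ^ (i + 1 + 1) * ((m + 2).choose (i + 1 + 1) : ℝ)
      = (-1 : ℝ) ^ i * ((m + 2).choose (i + 2) : ℝ) * y ^ (i + 2) := by
    intro i _
    rw [neg_pow y]
    ring
  rw [sum_congr rfl this]
  push_cast
  ring

lemma sum_alternating_choose_div_succ (m : ℕ) :
    ∑ i ∈ range (m + 1), (-1 : ℝ) ^ i * (m.choose i : ℝ) / (i + 1) = 1 / (m + 1) := by
  have h := Int.alternating_sum_range_choose_of_ne (n := m + 1) (by omega)
  rw [sum_range_succ'] at h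
  have h' : ∑ i ∈ range (m + 1), (-1 : ℝ) ^ i * ((m + 1).choose (i + 1) : ℝ) = 1 := by
    have := congrArg (Int.cast : ℤ → ℝ) h
    push_cast at this
    simp only [pow_succ, mul_neg, mul_one, neg_mul, sum_neg_distrib] at this
    simp at this
    linarith
  rw [show (1 : ℝ) / (m + 1) = _ / (m + 1) from congrArg (· / ((m : ℝ) + 1)) h'.symm, sum_div]
  refine sum_congr rfl fun i _ => ?_
  have := congrArg (Nat.cast : ℕ → ℝ) (Nat.add_one_mul_choose_eq m i)
  push_cast at this
  field_simp
  linear_combination this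

lemma sum_alternating_choose_succ_div_succ (m : ℕ) :
    ∑ i ∈ range m, (-1 : ℝ) ^ i * (m.choose (i + 1) : ℝ) / (i + 1) = (harmonic m : ℝ) := by
  induction m with
  | zero => simp
  | succ m ih =>
    have h : ∀ i ∈ range (m + 1), (-1 : ℝ) ^ i * ((m + 1).choose (i + 1) : ℝ) / (i + 1)
        = (-1 : ℝ) ^ i * (m.choose i : ℝ) / (i + 1)
          + (-1 : ℝ) ^ i * (m.choose (i + 1) : ℝ) / (i + 1) := by
      intro i _
      rw [Nat.choose_succ_succ]
      push_cast
      ring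
    rw [sum_congr rfl h, sum_add_distrib, sum_alternating_choose_div_succ, sum_range_succ, ih,
      harmonic_succ]
    simp
    ring

lemma sum_alternating_choose_add_two_div_succ (m : ℕ) :
    ∑ i ∈ range (m + 1), (-1 : ℝ) ^ i * ((m + 2).choose (i + 2) : ℝ) / (i + 1)
      = (m + 2) * (harmonic (m + 1) : ℝ) - (m + 1) := by
  induction m with
  | zero => simp [harmonic]; norm_num
  | succ m ih =>
    have h : ∀ i ∈ range (m + 2), (-1 : ℝ) ^ i * ((m + 1 + 2).choose (i + 2) : ℝ) / (i + 1)
        = (-1 : ℝ) ^ i * ((m + 2).choose (i + 1) : ℝ) / (i + 1)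
          + (-1 : ℝ) ^ i * ((m + 2).choose (i + 2) : ℝ) / (i + 1) := by
      intro i _
      rw [show m + 1 + 2 = (m + 2) + 1 by ring, Nat.choose_succ_succ]
      push_cast
      ring
    rw [sum_congr rfl h, sum_add_distrib, sum_alternating_choose_succ_div_succ, sum_range_succ, ih,
      harmonic_succ (m + 1), Nat.choose_eq_zero_of_lt (show m + 2 < m + 1 + 2 by omega)]
    push_cast
    field_simp
    ring

lemma hasDerivAt_one_sub_inv {x : ℝ} (hx : x ≠ 0) :
    HasDerivAt (fun x : ℝ => 1 - x⁻¹) (x⁻¹ ^ 2) x := by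
  refine ((hasDerivAt_inv hx).const_sub 1).congr_deriv ?_
  simp

/-- An antiderivative of `(1 - 1 / x) ^ (m + 2)`. -/
lemma hasDerivAt_primitive_one_sub_inv_pow (m : ℕ) {x : ℝ} (hx : x ≠ 0) :
    HasDerivAt (fun x : ℝ => x - (m + 2) * Real.log x
      - ∑ i ∈ range (m + 1), (-1 : ℝ) ^ i * ((m + 2).choose (i + 2) : ℝ) / (i + 1) * x⁻¹ ^ (i + 1))
      ((1 - x⁻¹) ^ (m + 2)) x := by
  rw [one_sub_pow_add_two]
  have hs : HasDerivAt (fun x : ℝ => ∑ i ∈ range (m + 1),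
      (-1 : ℝ) ^ i * ((m + 2).choose (i + 2) : ℝ) / (i + 1) * x⁻¹ ^ (i + 1))
      (∑ i ∈ range (m + 1), -((-1 : ℝ) ^ i * ((m + 2).choose (i + 2) : ℝ) * x⁻¹ ^ (i + 2))) x := by
    refine HasDerivAt.fun_sum fun i _ => ?_
    refine (((hasDerivAt_inv hx).fun_pow (i + 1)).const_mul
      ((-1 : ℝ) ^ i * ((m + 2).choose (i + 2) : ℝ) / (i + 1))).congr_deriv ?_
    have : (i : ℝ) + 1 ≠ 0 := by positivity
    simp only [Nat.add_sub_cancel]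
    push_cast
    rw [← inv_pow]
    generalize x⁻¹ = y
    field_simp
    ring
  refine (((hasDerivAt_id x).sub
    ((Real.hasDerivAt_log hx).const_mul ((m : ℝ) + 2))).sub hs).congr_deriv ?_
  rw [sum_neg_distrib]
  ring

lemma monotoneOn_Ici_of_hasDerivAt_nonneg {f f' : ℝ → ℝ} {a : ℝ}
    (hf : ∀ x, a ≤ x → HasDerivAt f (f' x) x) (hf' : ∀ x, a ≤ x → 0 ≤ f' x) :
    MonotoneOn f (Set.Ici a) :=
  monotoneOn_of_hasDerivWithinAt_nonneg (convex_Ici a)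
    (fun x hx => (hf x hx).continuousAt.continuousWithinAt)
    (fun x hx => (hf x (interior_subset hx)).hasDerivWithinAt)
    (fun x hx => hf' x (interior_subset hx))

/-- The trapezoid rule for `(1 - 1 / x) ^ (m + 2)` on `[1, M + 1]`. -/
lemma abs_sum_one_sub_inv_pow_sub_le (m M : ℕ) :
    |∑ i ∈ range (M + 1), (1 - (1 + (i : ℝ))⁻¹) ^ (m + 2) - (1 - (1 + (M : ℝ))⁻¹) ^ (m + 2) / 2
      - ((1 + (M : ℝ)) - (m + 2) * Real.log (1 + M)
        - ∑ i ∈ range (m + 1), (-1 : ℝ) ^ i * ((m + 2).choose (i + 2) : ℝ) / (i + 1)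
            * (1 + (M : ℝ))⁻¹ ^ (i + 1)
        - 1 + ((m + 2) * (harmonic (m + 1) : ℝ) - (m + 1)))|
      ≤ ((m + 2) * (1 - (1 + (M : ℝ))⁻¹) ^ (m + 1) * (1 + (M : ℝ))⁻¹ ^ 2
        + (4 * (1 - (1 + (M : ℝ))⁻¹) ^ (m + 2)
          - 4 * (m + 2) / (m + 3) * (1 - (1 + (M : ℝ))⁻¹) ^ (m + 3))) / 2 := by
  set g : ℝ → ℝ := fun x => (m + 2) * (1 - x⁻¹) ^ (m + 1) * x⁻¹ ^ 2 with hg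
  set L : ℝ → ℝ := fun x => 4 * (1 - x⁻¹) ^ (m + 2) - 4 * (m + 2) / (m + 3) * (1 - x⁻¹) ^ (m + 3)
    with hL
  have hm3 : (m : ℝ) + 3 ≠ 0 := by positivity
  have hv : ∀ x : ℝ, 1 ≤ x → 0 ≤ x⁻¹ ∧ 0 ≤ 1 - x⁻¹ := fun x hx =>
    ⟨by positivity, sub_nonneg.2 (inv_le_one_of_one_le₀ hx)⟩
  have hLd : ∀ x : ℝ, 1 ≤ x →
      HasDerivAt L (4 * (m + 2) * (1 - x⁻¹) ^ (m + 1) * x⁻¹ ^ 3) x := by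
    intro x hx
    have hd := hasDerivAt_one_sub_inv (zero_lt_one.trans_le hx).ne'
    refine (((hd.fun_pow (m + 2)).const_mul 4).sub
      ((hd.fun_pow (m + 3)).const_mul (4 * ((m : ℝ) + 2) / (m + 3)))).congr_deriv ?_
    simp only [show m + 2 - 1 = m + 1 by omega, show m + 3 - 1 = m + 2 by omega]
    push_cast
    generalize x⁻¹ = y
    field_simp
    ring
  have hgd : ∀ x : ℝ, 1 ≤ x → HasDerivAt g ((m + 2) * (m + 1) * (1 - x⁻¹) ^ m * x⁻¹ ^ 4
      - 2 * (m + 2) * (1 - x⁻¹) ^ (m + 1) * x⁻¹ ^ 3) x := by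
    intro x hx
    have hx0 := (zero_lt_one.trans_le hx).ne'
    have hd := hasDerivAt_one_sub_inv hx0
    refine (((hd.fun_pow (m + 1)).const_mul ((m : ℝ) + 2)).mul
      ((hasDerivAt_inv hx0).fun_pow 2)).congr_deriv ?_
    simp only [Nat.add_sub_cancel]
    push_cast
    rw [← inv_pow]
    ring
  have key := abs_trapezoid_sum_le (a := 1) (K := fun x => g x + L x) (g := g)
    (fun x hx => hasDerivAt_primitive_one_sub_inv_pow m (zero_lt_one.trans_le hx).ne')
    (fun x hx => by
      refine ((hasDerivAt_one_sub_inv (zero_lt_one.trans_le hx).ne').fun_pow (m + 2)).congr_deriv ?_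
      simp [hg])
    (by
      simp only [add_sub_cancel_left]
      refine monotoneOn_Ici_of_hasDerivAt_nonneg hLd fun x hx => ?_
      obtain ⟨h1, h2⟩ := hv x hx
      positivity)
    (by
      refine monotoneOn_Ici_of_hasDerivAt_nonneg
        (fun x hx => ((hgd x hx).add (hLd x hx)).add (hgd x hx)) fun x hx => ?_
      obtain ⟨h1, h2⟩ := hv x hx
      have : 0 ≤ 2 * (((m : ℝ) + 2) * (m + 1) * (1 - x⁻¹) ^ m * x⁻¹ ^ 4) := by positivity
      linarith) M
  have h1 : g 1 + L 1 = 0 := by simp [hg, hL]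
  refine le_trans (le_of_eq ?_) (key.trans ?_)
  · congr 1
    simp only [inv_one, sub_self, one_pow, mul_one, Real.log_one, mul_zero,
      sum_alternating_choose_add_two_div_succ]
    ring
  · rw [h1, sub_zero]

lemma tendsto_harmonic_add_sub_log (n : ℕ) :
    Filter.Tendsto (fun M : ℕ => (harmonic (n + M) : ℝ) - Real.log ((n : ℝ) + M)) Filter.atTop
      (nhds Real.eulerMascheroniConstant) := by
  have h := (Filter.tendsto_add_atTop_iff_nat n).2 Real.tendsto_harmonic_sub_log
  refine h.congr fun M => ?_
  rw [add_comm M n]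
  push_cast
  rfl

lemma tendsto_inv_natCast_add (n : ℕ) :
    Filter.Tendsto (fun M : ℕ => ((n : ℝ) + M)⁻¹) Filter.atTop (nhds 0) :=
  (Filter.tendsto_atTop_add_const_left _ _ tendsto_natCast_atTop_atTop).inv_tendsto_atTop

lemma abs_harmonic_sub_log_sub_le (n : ℕ) (hn : 1 ≤ n) :
    |Real.eulerMascheroniConstant - ((harmonic n : ℝ) - Real.log n) + 1 / (2 * n)|
      ≤ 1 / (2 * (n : ℝ) ^ 2) := by
  have hn0 : (0 : ℝ) < n := by exact_mod_cast hn
  have key := abs_trapezoid_sum_le (a := (n : ℝ)) (H := Real.log) (h := fun x => x⁻¹)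
    (g := fun x => -(x ^ 2)⁻¹) (K := fun x => -(x ^ 2)⁻¹)
    (fun x hx => Real.hasDerivAt_log (hn0.trans_le hx).ne')
    (fun x hx => hasDerivAt_inv (hn0.trans_le hx).ne')
    (by simp only [sub_self]; exact monotoneOn_const)
    (by
      intro x hx y hy hxy
      have hx0 : 0 < x := hn0.trans_le hx
      have : (y ^ 2)⁻¹ ≤ (x ^ 2)⁻¹ := by gcongr
      simp only
      linarith)
  have hsum : ∀ M : ℕ, ∑ i ∈ range (M + 1), ((n : ℝ) + i)⁻¹
      = harmonic (n + M) - harmonic n + (n : ℝ)⁻¹ := by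
    intro M
    induction M with
    | zero => simp
    | succ M ih =>
      rw [sum_range_succ, ih, ← add_assoc n M 1, harmonic_succ]
      push_cast
      ring
  have hlim : Filter.Tendsto (fun M : ℕ => ∑ i ∈ range (M + 1), ((n : ℝ) + i)⁻¹
      - ((n : ℝ)⁻¹ + ((n : ℝ) + M)⁻¹) / 2 - (Real.log (n + M) - Real.log n)) Filter.atTop
      (nhds (Real.eulerMascheroniConstant - ((harmonic n : ℝ) - Real.log n) + 1 / (2 * n))) := by
    have h := ((tendsto_harmonic_add_sub_log n).sub
      ((tendsto_inv_natCast_add n).div_const 2)).add_const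
        (-(harmonic n : ℝ) + (n : ℝ)⁻¹ / 2 + Real.log n)
    convert h using 1
    · funext M
      rw [hsum]
      ring
    · congr 1
      field_simp
      ring
  refine le_of_tendsto hlim.abs (Filter.Eventually.of_forall fun M => (key M).trans ?_)
  have : 0 ≤ (((n : ℝ) + M) ^ 2)⁻¹ := by positivity
  have h2 : 1 / (2 * (n : ℝ) ^ 2) = ((n : ℝ) ^ 2)⁻¹ / 2 := by field_simp
  rw [h2]
  linarith

/-- The partial sums of the zeta series, combined by the binomial theorem. -/
lemma sum_alternating_choose_mul_sum_range (m M : ℕ) :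
    ∑ i ∈ range (m + 1), (-1 : ℝ) ^ i * ((m + 2).choose (i + 2) : ℝ)
        * ∑ j ∈ range (M + 1), (1 / ((j : ℝ) + 1) ^ (i + 2))
      = ∑ j ∈ range (M + 1), (1 - (1 + (j : ℝ))⁻¹) ^ (m + 2) - (1 + M)
        + (m + 2) * harmonic (1 + M) := by
  simp only [one_sub_pow_add_two, sum_add_distrib, sum_sub_distrib]
  have h : ∑ j ∈ range (M + 1), ((m : ℝ) + 2) * (1 + (j : ℝ))⁻¹ = (m + 2) * harmonic (1 + M) := by
    rw [← mul_sum, add_comm 1 M, harmonic]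
    push_cast
    simp only [add_comm]
  rw [h, sum_comm (s := range (M + 1))]
  simp only [mul_sum, sum_const, card_range, nsmul_eq_mul, one_div, inv_pow, add_comm (1 : ℝ)]
  push_cast
  ring

lemma abs_sum_alternating_choose_mul_tsum_sub_le (m : ℕ) :
    |∑ k ∈ Icc 2 (m + 2), (-1 : ℝ) ^ k * ((m + 2).choose k : ℝ)
        * ∑' j : ℕ, (1 / ((j : ℝ) + 1) ^ k)
      - ((m + 2) * (harmonic (m + 1) + Real.eulerMascheroniConstant - 1) + 1 / 2)|
      ≤ 2 / (m + 3) := by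
  have hre : ∑ k ∈ Icc 2 (m + 2), (-1 : ℝ) ^ k * ((m + 2).choose k : ℝ)
        * ∑' j : ℕ, (1 / ((j : ℝ) + 1) ^ k)
      = ∑ i ∈ range (m + 1), (-1 : ℝ) ^ i * ((m + 2).choose (i + 2) : ℝ)
        * ∑' j : ℕ, (1 / ((j : ℝ) + 1) ^ (i + 2)) := by
    rw [← Finset.Ico_add_one_right_eq_Icc, sum_Ico_eq_sum_range]
    refine sum_congr (by congr 1) fun i _ => ?_
    rw [add_comm 2 i, pow_add (-1 : ℝ)]
    norm_num
  have hS : Filter.Tendsto (fun M : ℕ => ∑ i ∈ range (m + 1),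
      (-1 : ℝ) ^ i * ((m + 2).choose (i + 2) : ℝ)
        * ∑ j ∈ range (M + 1), (1 / ((j : ℝ) + 1) ^ (i + 2))) Filter.atTop
      (nhds (∑ i ∈ range (m + 1), (-1 : ℝ) ^ i * ((m + 2).choose (i + 2) : ℝ)
        * ∑' j : ℕ, (1 / ((j : ℝ) + 1) ^ (i + 2)))) := by
    refine tendsto_finsetSum _ fun i _ => Filter.Tendsto.const_mul _ ?_
    have hs : Summable fun j : ℕ => 1 / ((j : ℝ) + 1) ^ (i + 2) := by
      have := (summable_nat_add_iff 1).2 (Real.summable_one_div_nat_pow.2 (show 1 < i + 2 by omega))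
      exact_mod_cast this
    exact (Filter.tendsto_add_atTop_iff_nat 1).2 hs.hasSum.tendsto_sum_nat
  have hγ := tendsto_harmonic_add_sub_log 1
  have hinv := tendsto_inv_natCast_add 1
  simp only [Nat.cast_one] at hγ hinv
  have hcomp : ∀ F : ℝ → ℝ, Continuous F →
      Filter.Tendsto (fun M : ℕ => F (1 + (M : ℝ))⁻¹) Filter.atTop (nhds (F 0)) :=
    fun F hF => (hF.tendsto 0).comp hinv
  have hR := hcomp (fun y => -((1 - y) ^ (m + 2) / 2) + ∑ i ∈ range (m + 1),
    (-1 : ℝ) ^ i * ((m + 2).choose (i + 2) : ℝ) / (i + 1) * y ^ (i + 1)) (by fun_prop)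
  have hB := hcomp (fun y => ((m + 2) * (1 - y) ^ (m + 1) * y ^ 2
        + (4 * (1 - y) ^ (m + 2) - 4 * (m + 2) / (m + 3) * (1 - y) ^ (m + 3))) / 2) (by fun_prop)
  have hE := ((hS.sub (hγ.const_mul ((m : ℝ) + 2))).add hR).add_const
    (1 - ((m + 2) * (harmonic (m + 1) : ℝ) - (m + 1)))
  rw [hre]
  refine le_of_eq_of_le (congrArg abs ?_) ((le_of_tendsto_of_tendsto' hE.abs hB fun M =>
    le_of_eq_of_le (congrArg abs ?_) (abs_sum_one_sub_inv_pow_sub_le m M)).trans_eq ?_)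
  · simp
    ring
  · rw [sum_alternating_choose_mul_sum_range]
    ring
  · simp
    field_simp
    ring

/-- With `ζ` the Riemann zeta function
(`ζ(k) = ∑_{j≥1} j⁻ᵏ`) and `γ` the Euler–Mascheroni constant,
`∑_{k=2}^n (-1)^k C(n,k) ζ(k) = n log n + (2γ - 1) n + O(1/n)`. -/
theorem stmt_15 :
    ∃ C : ℝ, ∀ n : ℕ, 2 ≤ n →
      |(∑ k ∈ Icc 2 n, (-1 : ℝ) ^ k * (n.choose k : ℝ)
            * ∑' j : ℕ, (1 / ((j : ℝ) + 1) ^ k))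
          - (n : ℝ) * Real.log n - (2 * Real.eulerMascheroniConstant - 1) * n|
        ≤ C / n := by
  refine ⟨3, fun n hn => ?_⟩
  obtain ⟨m, rfl⟩ := Nat.exists_eq_add_of_le' hn
  have h1 := abs_sum_alternating_choose_mul_tsum_sub_le m
  have h2 := abs_harmonic_sub_log_sub_le (m + 2) (by omega)
  set S := ∑ k ∈ Icc 2 (m + 2), (-1 : ℝ) ^ k * ((m + 2).choose k : ℝ)
    * ∑' j : ℕ, (1 / ((j : ℝ) + 1) ^ k)
  rw [harmonic_succ (m + 1)] at h2
  push_cast at h2 ⊢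
  have hm : (0 : ℝ) < m + 2 := by positivity
  set A := Real.eulerMascheroniConstant
    - ((harmonic (m + 1) : ℝ) + ((m : ℝ) + 1 + 1)⁻¹ - Real.log (m + 2)) + 1 / (2 * (m + 2)) with hA
  have he : S - (m + 2) * Real.log (m + 2) - (2 * Real.eulerMascheroniConstant - 1) * (m + 2)
      = (S - ((m + 2) * (harmonic (m + 1) + Real.eulerMascheroniConstant - 1) + 1 / 2))
        - (m + 2) * A := by
    rw [hA, show (m : ℝ) + 1 + 1 = m + 2 by ring]
    field_simp
    ring
  rw [he]
  refine (abs_sub _ _).trans ?_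
  rw [abs_mul, abs_of_pos hm]
  have h3 : (2 : ℝ) / (m + 3) ≤ 2 / (m + 2) := by gcongr; norm_num
  have h4 : ((m : ℝ) + 2) * |A| ≤ 1 / (m + 2) := by
    calc ((m : ℝ) + 2) * |A| ≤ (m + 2) * (1 / (2 * ((m : ℝ) + 2) ^ 2)) := by gcongr
      _ = 1 / (m + 2) / 2 := by field_simp
      _ ≤ 1 / (m + 2) := half_le_self (by positivity)
  calc _ ≤ 2 / ((m : ℝ) + 2) + 1 / (m + 2) := add_le_add (h1.trans h3) h4
    _ = 3 / (m + 2) := by ring
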